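/- Let P and Q be complex d_a × d_a matrices that are orthogonal projections (P² = P, Q² = Q, P* = P, Q* = Q, P·Q = 0) with P + Q = 1. For a real measurement strength x, set τ₁ = √((1 − tanh x)/2) and τ₂ = √((1 + tanh x)/2), and define the weak measurement operators Ω_x = τ₁P + τ₂Q and Ω_{−x} = τ₂P + τ₁Q. Then for every complex (d_a·d_b) × (d_a·d_b) matrix ρ (indexed by pairs), (Ω_x ⊗ 1) ρ (Ω_x ⊗ 1) + (Ω_{−x} ⊗ 1) ρ (Ω_{−x} ⊗ 1) = sech(x) · ρ + (1 − sech x) · [(P ⊗ 1) ρ (P ⊗ 1) + (Q ⊗ 1) ρ (Q ⊗ 1)]. -/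

import Mathlib

open Matrix Kronecker BigOperators

/-- For `a + b = 1`, the sum of the two sandwiches of `r` by `s • a + t • b` and `t • a + s • b`
interpolates between `r` and its pinching `a * r * a + b * r * b`. -/
lemma sandwich_add_sandwich_eq {R A : Type*} [CommRing R] [Ring A] [Algebra R A]
    {a b : A} (hab : a + b = 1) {s t c : R} (hsq : s ^ 2 + t ^ 2 = 1) (hc : 2 * (s * t) = c)
    (r : A) :
    (s • a + t • b) * r * (s • a + t • b) + (t • a + s • b) * r * (t • a + s • b)
      = c • r + (1 - c) • (a * r * a + b * r * b) := by
  have hr : r = a * r * a + a * r * b + (b * r * a + b * r * b) := by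
    rw [← mul_add, ← mul_add, hab, mul_one, mul_one, ← add_mul, hab, one_mul]
  calc
    _ = (s ^ 2 + t ^ 2) • (a * r * a + b * r * b)
          + (2 * (s * t)) • (a * r * b + b * r * a) := by
      simp only [add_mul, mul_add, smul_mul_assoc, mul_smul_comm]
      module
    _ = c • (a * r * a + a * r * b + (b * r * a + b * r * b))
          + (1 - c) • (a * r * a + b * r * b) := by
      rw [hsq, hc]
      module
    _ = _ := by rw [← hr]

lemma Real.one_sub_tanh_nonneg (x : ℝ) : 0 ≤ 1 - Real.tanh x :=
  sub_nonneg.2 (Real.tanh_lt_one x).le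

lemma Real.one_add_tanh_nonneg (x : ℝ) : 0 ≤ 1 + Real.tanh x := by
  linarith [Real.neg_one_lt_tanh x]

lemma Real.sq_sqrt_half_one_sub_tanh_add (x : ℝ) :
    √((1 - Real.tanh x) / 2) ^ 2 + √((1 + Real.tanh x) / 2) ^ 2 = 1 := by
  rw [Real.sq_sqrt (div_nonneg (Real.one_sub_tanh_nonneg x) zero_le_two),
    Real.sq_sqrt (div_nonneg (Real.one_add_tanh_nonneg x) zero_le_two)]
  ring

lemma Real.two_mul_sqrt_half_one_sub_tanh_mul (x : ℝ) :
    2 * (√((1 - Real.tanh x) / 2) * √((1 + Real.tanh x) / 2)) = 1 / Real.cosh x := by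
  have hcosh := Real.cosh_pos x
  have h : (1 - Real.tanh x) / 2 * ((1 + Real.tanh x) / 2) = (1 / (2 * Real.cosh x)) ^ 2 := by
    rw [Real.tanh_eq_sinh_div_cosh]
    field_simp
    linear_combination Real.cosh_sq_sub_sinh_sq x
  rw [← Real.sqrt_mul (div_nonneg (Real.one_sub_tanh_nonneg x) zero_le_two), h,
    Real.sqrt_sq (by positivity)]
  field_simp

/-- the two-outcome weak measurement channel equals
`sech x • ρ + (1 - sech x) • (projective measurement of ρ)`. -/
theorem weak_measurement_channel_eq
    (da db : ℕ) (P Q : Matrix (Fin da) (Fin da) ℂ)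
    (hP : P * P = P) (hQ : Q * Q = Q)
    (hPsa : Pᴴ = P) (hQsa : Qᴴ = Q)
    (hPQ : P * Q = 0) (hsum : P + Q = 1)
    (x τ₁ τ₂ : ℝ)
    (hτ₁ : τ₁ = Real.sqrt ((1 - Real.tanh x) / 2))
    (hτ₂ : τ₂ = Real.sqrt ((1 + Real.tanh x) / 2))
    (Ωx Ωmx : Matrix (Fin da) (Fin da) ℂ)
    (hΩx : Ωx = (τ₁ : ℂ) • P + (τ₂ : ℂ) • Q)
    (hΩmx : Ωmx = (τ₂ : ℂ) • P + (τ₁ : ℂ) • Q)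
    (ρ : Matrix (Fin da × Fin db) (Fin da × Fin db) ℂ) :
    (Ωx ⊗ₖ (1 : Matrix (Fin db) (Fin db) ℂ)) * ρ * (Ωx ⊗ₖ (1 : Matrix (Fin db) (Fin db) ℂ))
      + (Ωmx ⊗ₖ (1 : Matrix (Fin db) (Fin db) ℂ)) * ρ * (Ωmx ⊗ₖ (1 : Matrix (Fin db) (Fin db) ℂ))
    = ((1 / Real.cosh x : ℝ) : ℂ) • ρ
      + ((1 - 1 / Real.cosh x : ℝ) : ℂ) •
        ((P ⊗ₖ (1 : Matrix (Fin db) (Fin db) ℂ)) * ρ * (P ⊗ₖ (1 : Matrix (Fin db) (Fin db) ℂ))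
          + (Q ⊗ₖ (1 : Matrix (Fin db) (Fin db) ℂ)) * ρ * (Q ⊗ₖ (1 : Matrix (Fin db) (Fin db) ℂ))) := by
  subst hτ₁ hτ₂ hΩx hΩmx
  simp only [add_kronecker, smul_kronecker, Complex.ofReal_sub, Complex.ofReal_one]
  refine sandwich_add_sandwich_eq ?_ ?_ ?_ ρ
  · rw [← add_kronecker, hsum, one_kronecker_one]
  · exact_mod_cast Real.sq_sqrt_half_one_sub_tanh_add x
  · exact_mod_cast Real.two_mul_sqrt_half_one_sub_tanh_mul x
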